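/- arXiv:1602.07570 — 2 statements merged into one kernel-verified Lean document; each statement's English description precedes it below -/
import Mathlib

section
/- Consider Bayesian Exploration with deterministic utilities; assume there is a single agent per round (n = 1), the principal's reward coincides with the agent's utility (f = u_1), and every action is eventually-explorable for every state θ in the support of ψ (A^det_θ = A). Then OPT(Π_BIC) = E_{θ∼ψ}[ max_{a∈A} f(a,θ) ], the expected reward of the best fixed action. -/
open scoped BigOperators

attribute [local instance] Classical.propDecidable

noncomputable section

namespace BE

variable {n : ℕ} {Θ : Type} {A : Fin n → Type} {X : Type} {X' : Type}

/-- Joint actions: one action per agent. -/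
abbrev JA (A : Fin n → Type) : Type := (i : Fin n) → A i

/-- A realized utility vector: the principal's reward together with each agent's utility. -/
abbrev UVec (n : ℕ) : Type := ℝ × (Fin n → ℝ)

/-- A history: the joint actions chosen and the utility vectors realized so far,
most recent round first. -/
abbrev Hist (A : Fin n → Type) : Type := List (JA A × UVec n)

/-- A (discrete) probability mass function. -/
def IsDPMF {V : Type*} (m : V → ℝ) : Prop :=
  (∀ v, 0 ≤ m v) ∧ HasSum m 1

/-- A prior over the finite state space. -/
def IsPrior [Fintype Θ] (ψ : Θ → ℝ) : Prop :=
  (∀ θ, 0 ≤ ψ θ) ∧ ∑ θ, ψ θ = 1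

/-- Rewards and utilities take values in `[0,1]`. -/
def IsUtil (f : JA A → Θ → ℝ) (u : (i : Fin n) → JA A → Θ → ℝ) : Prop :=
  (∀ a θ, f a θ ∈ Set.Icc (0:ℝ) 1) ∧ ∀ i a θ, u i a θ ∈ Set.Icc (0:ℝ) 1

/-- A stochastic-utility environment `D`: for every joint action `a` and state `θ`,
`D a θ` is a distribution over realized utility vectors supported in `[0,1]^{n+1}`
whose coordinate means are `f a θ` and `u i a θ`. -/
def IsEnv (D : JA A → Θ → UVec n → ℝ) (f : JA A → Θ → ℝ)
    (u : (i : Fin n) → JA A → Θ → ℝ) : Prop :=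
  ∀ a θ, IsDPMF (D a θ) ∧
    (∀ v, D a θ v ≠ 0 → v.1 ∈ Set.Icc (0:ℝ) 1 ∧ ∀ i, v.2 i ∈ Set.Icc (0:ℝ) 1) ∧
    (∑' v : UVec n, D a θ v * v.1) = f a θ ∧
    (∀ i, (∑' v : UVec n, D a θ v * v.2 i) = u i a θ)

/-- The deterministic instance: realized utilities deterministically equal expectations. -/
def detD (f : JA A → Θ → ℝ) (u : (i : Fin n) → JA A → Θ → ℝ) :
    JA A → Θ → UVec n → ℝ :=
  fun a θ v => if v = ((f a θ, fun i => u i a θ) : UVec n) then (1:ℝ) else 0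

/-- An iterative recommendation policy, represented by its per-round conditional
action distributions given the history observed so far. -/
def IsPolicy [∀ i, Fintype (A i)] (P : ℕ → Hist A → JA A → ℝ) : Prop :=
  ∀ t h, (∀ a, 0 ≤ P t h a) ∧ ∑ a : JA A, P t h a = 1

/-- Probability, conditional on the realized state `θ`, of observing history `h`
when all agents follow the recommendations of policy `P` in environment `D`. -/
def histProb (P : ℕ → Hist A → JA A → ℝ) (D : JA A → Θ → UVec n → ℝ) (θ : Θ) :
    Hist A → ℝ
  | [] => 1
  | av :: h => histProb P D θ h * P h.length h av.1 * D av.1 θ av.2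

/-- Conditional (on `θ* = θ`) expectation of `g (aₜ, θ)` in round `t` (0-indexed). -/
def roundCond [∀ i, Fintype (A i)] (P : ℕ → Hist A → JA A → ℝ)
    (D : JA A → Θ → UVec n → ℝ) (θ : Θ) (t : ℕ) (g : JA A → Θ → ℝ) : ℝ :=
  ∑' h : Hist A,
    if h.length = t then histProb P D θ h * ∑ a : JA A, P t h a * g a θ else 0

/-- Expectation of `g (aₜ, θ*)` in round `t` (0-indexed). -/
def roundExp [Fintype Θ] [∀ i, Fintype (A i)] (ψ : Θ → ℝ)
    (P : ℕ → Hist A → JA A → ℝ) (D : JA A → Θ → UVec n → ℝ) (t : ℕ)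
    (g : JA A → Θ → ℝ) : ℝ :=
  ∑ θ, ψ θ * roundCond P D θ t g

/-- Conditional (on `θ* = θ`) probability that policy `P` plays the joint action `a`
in round `t` (0-indexed). -/
def probAt [∀ i, Fintype (A i)] (P : ℕ → Hist A → JA A → ℝ)
    (D : JA A → Θ → UVec n → ℝ) (θ : Θ) (t : ℕ) (a : JA A) : ℝ :=
  ∑' h : Hist A, if h.length = t then histProb P D θ h * P t h a else 0

/-- δ-Bayesian incentive-compatibility at round `t` (0-indexed), stated in the
equivalent indicator-weighted (unconditional) form: for every agent `i` and actions
`ai, ai'`, the expected gain of following the recommendation `ai` over deviating to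
`ai'` (weighted by the event of being recommended `ai`) is at least `δ` times the
probability of being recommended `ai`. -/
def BICAt [Fintype Θ] [∀ i, Fintype (A i)] (ψ : Θ → ℝ)
    (P : ℕ → Hist A → JA A → ℝ) (D : JA A → Θ → UVec n → ℝ)
    (u : (i : Fin n) → JA A → Θ → ℝ) (δ : ℝ) (t : ℕ) : Prop :=
  ∀ (i : Fin n) (ai ai' : A i),
    δ * roundExp ψ P D t (fun a _ => if a i = ai then 1 else 0) ≤
      roundExp ψ P D t
        (fun a θ => if a i = ai then u i a θ - u i (Function.update a i ai') θ else 0)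

/-- δ-BIC iterative recommendation policy (`δ = 0` is plain BIC). -/
def IsBIC [Fintype Θ] [∀ i, Fintype (A i)] (ψ : Θ → ℝ)
    (P : ℕ → Hist A → JA A → ℝ) (D : JA A → Θ → UVec n → ℝ)
    (u : (i : Fin n) → JA A → Θ → ℝ) (δ : ℝ) : Prop :=
  IsPolicy P ∧ ∀ t, BICAt ψ P D u δ t

/-- Cumulative expected reward over the first `T` rounds. -/
def REW [Fintype Θ] [∀ i, Fintype (A i)] (ψ : Θ → ℝ)
    (P : ℕ → Hist A → JA A → ℝ) (D : JA A → Θ → UVec n → ℝ)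
    (f : JA A → Θ → ℝ) (T : ℕ) : ℝ :=
  ∑ t ∈ Finset.range T, roundExp ψ P D t f

/-- The one-round benchmark `OPT` over a class `C` of policies. -/
def OPT [Fintype Θ] [∀ i, Fintype (A i)] (ψ : Θ → ℝ)
    (D : JA A → Θ → UVec n → ℝ) (f : JA A → Θ → ℝ)
    (C : (ℕ → Hist A → JA A → ℝ) → Prop) : ℝ :=
  sSup {r : ℝ | ∃ P, C P ∧ ∃ t : ℕ, r = roundExp ψ P D t f}

/-- A signal structure: the conditional distribution of the signal given the state. -/
def IsSigKernel (q : Θ → X → ℝ) : Prop :=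
  ∀ θ, (∀ s, 0 ≤ q θ s) ∧ HasSum (q θ) 1

/-- LP-representation of a recommendation policy in the recommendation game. -/
def IsRecPolicy [∀ i, Fintype (A i)] (x : JA A → X → ℝ) : Prop :=
  (∀ a s, 0 ≤ x a s) ∧ ∀ s, ∑ a : JA A, x a s = 1

/-- Membership in the polytope of δ-BIC recommendation policies (`δ = 0` is `BIC[S]`). -/
def InBIC [Fintype Θ] [∀ i, Fintype (A i)] (ψ : Θ → ℝ) (q : Θ → X → ℝ)
    (u : (i : Fin n) → JA A → Θ → ℝ) (δ : ℝ) (x : JA A → X → ℝ) : Prop :=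
  IsRecPolicy x ∧ ∀ (i : Fin n) (ai ai' : A i),
    δ * (∑ θ, ψ θ * ∑' s : X, q θ s * ∑ a : JA A, (if a i = ai then x a s else 0)) ≤
      ∑ θ, ψ θ * ∑' s : X, q θ s *
        ∑ a : JA A,
          (if a i = ai then (u i a θ - u i (Function.update a i ai') θ) * x a s else 0)

/-- Expected reward of a recommendation policy `x`, with reward function `f`. -/
def recREW [Fintype Θ] [∀ i, Fintype (A i)] (ψ : Θ → ℝ) (q : Θ → X → ℝ)
    (f : JA A → Θ → ℝ) (x : JA A → X → ℝ) : ℝ :=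
  ∑ θ, ψ θ * ∑' s : X, q θ s * ∑ a : JA A, x a s * f a θ

/-- `REW*[S]`: the optimal expected reward over δ-BIC recommendation policies. -/
def REWstar [Fintype Θ] [∀ i, Fintype (A i)] (ψ : Θ → ℝ) (q : Θ → X → ℝ)
    (f : JA A → Θ → ℝ) (u : (i : Fin n) → JA A → Θ → ℝ) (δ : ℝ) : ℝ :=
  sSup {r : ℝ | ∃ x : JA A → X → ℝ, InBIC ψ q u δ x ∧ r = recREW ψ q f x}

/-- `EX_s[S]`: the signal-explorable joint actions at the feasible signal `s`. -/
def EXs [Fintype Θ] [∀ i, Fintype (A i)] (ψ : Θ → ℝ) (q : Θ → X → ℝ)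
    (u : (i : Fin n) → JA A → Θ → ℝ) (s : X) : Set (JA A) :=
  {a | ∃ x : JA A → X → ℝ, InBIC ψ q u 0 x ∧ 0 < x a s}

/-- Value type of the `AllInfo` signal. -/
abbrev AIVal (A : Fin n → Type) : Type := Finset (JA A) × (JA A → UVec n)

/-- The realization, at state `θ`, of the signal `AllInfo(B)`: the set `B θ` together
with the rewards/utilities of all joint actions in `B θ`. -/
def allInfoVal [∀ i, Fintype (A i)] (B : Θ → Finset (JA A)) (f : JA A → Θ → ℝ)
    (u : (i : Fin n) → JA A → Θ → ℝ) (θ : Θ) : AIVal A :=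
  (B θ, fun a => if a ∈ B θ then ((f a θ, fun i => u i a θ) : UVec n)
                 else (((0:ℝ), fun _ => (0:ℝ)) : UVec n))

/-- The signal kernel of `AllInfo(B)`. -/
def qAI [∀ i, Fintype (A i)] (B : Θ → Finset (JA A)) (f : JA A → Θ → ℝ)
    (u : (i : Fin n) → JA A → Θ → ℝ) : Θ → AIVal A → ℝ :=
  fun θ v => if v = allInfoVal B f u θ then (1:ℝ) else 0

/-- The set of δ-eventually-explorable joint actions given the state `θ`, for the
environment `D`: actions played with positive probability in some round by some
δ-BIC iterative recommendation policy. -/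
def explSet [Fintype Θ] [∀ i, Fintype (A i)] (ψ : Θ → ℝ)
    (D : JA A → Θ → UVec n → ℝ) (u : (i : Fin n) → JA A → Θ → ℝ) (δ : ℝ)
    (θ : Θ) : Finset (JA A) :=
  (Set.toFinite {a : JA A | ∃ P, IsBIC ψ P D u δ ∧ ∃ t, 0 < probAt P D θ t a}).toFinset

/-! ### Policies and histories in a deterministic environment -/

/-- The utility vector realized by the joint action `a` in state `θ` when utilities are
deterministic. -/
def outcome (f : JA A → Θ → ℝ) (u : (i : Fin n) → JA A → Θ → ℝ) (a : JA A) (θ : Θ) : UVec n :=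
  (f a θ, fun i => u i a θ)

section Histories

variable {f : JA A → Θ → ℝ} {u : (i : Fin n) → JA A → Θ → ℝ} {P : ℕ → Hist A → JA A → ℝ}
  {R : Hist A → ℕ → Hist A → JA A → ℝ} {θ : Θ} {t T : ℕ}

theorem histProb_eq_zero {h : Hist A} {p : JA A × UVec n} (hp : p ∈ h)
    (hne : p.2 ≠ outcome f u p.1 θ) : histProb P (detD f u) θ h = 0 := by
  induction h with
  | nil => simp at hp
  | cons q h ih =>
    rcases List.mem_cons.1 hp with rfl | hp
    · have : detD f u p.1 θ p.2 = 0 := if_neg hne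
      simp [histProb, this]
    · simp [histProb, ih hp]

/-- Run `P` for `T` rounds, and continue with the policy `R h` restarted from an empty history,
where `h` is the history of the first `T` rounds. -/
def concat (P : ℕ → Hist A → JA A → ℝ) (T : ℕ) (R : Hist A → ℕ → Hist A → JA A → ℝ) :
    ℕ → Hist A → JA A → ℝ :=
  fun t h => if t < T then P t h else R (h.drop (t - T)) (t - T) (h.take (t - T))

theorem concat_of_lt (h : t < T) : concat P T R t = P t := by
  funext
  simp [concat, h]

theorem concat_append {h' : Hist A} (hl : h'.length = t) (h : Hist A) :
    concat P T R (T + t) (h' ++ h) = R h t h' := by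
  subst hl
  funext
  simp [concat]

/-- The indicator that the joint action `a` does not occur in the history `h`. -/
def unseen (a : JA A) (h : Hist A) : ℝ := if ∃ p ∈ h, p.1 = a then 0 else 1

theorem unseen_nonneg (a : JA A) (h : Hist A) : 0 ≤ unseen a h := by
  unfold unseen
  split_ifs <;> norm_num

theorem unseen_le_one (a : JA A) (h : Hist A) : unseen a h ≤ 1 := by
  unfold unseen
  split_ifs <;> norm_num

theorem unseen_append (a : JA A) (h' h : Hist A) :
    unseen a (h' ++ h) = unseen a h * unseen a h' := by
  by_cases h1 : ∃ p ∈ h, p.1 = a <;> by_cases h2 : ∃ p ∈ h', p.1 = a <;>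
    simp only [unseen, List.mem_append, or_and_right, exists_or, h1, h2] <;> norm_num

/-- The policy that always recommends the joint action `a`. -/
def constPolicy (a : JA A) : ℕ → Hist A → JA A → ℝ := fun _ _ b => if b = a then 1 else 0

variable [∀ i, Fintype (A i)]

/-! ### Expectations over histories -/

/-- The histories of length `t` that are compatible with the state `θ`. -/
def hists (f : JA A → Θ → ℝ) (u : (i : Fin n) → JA A → Θ → ℝ) (θ : Θ) : ℕ → Finset (Hist A)
  | 0 => {[]}
  | t + 1 => ((Finset.univ : Finset (JA A)) ×ˢ hists f u θ t).image
      fun p => (p.1, outcome f u p.1 θ) :: p.2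

theorem mem_hists {h : Hist A} :
    h ∈ hists f u θ t ↔ h.length = t ∧ ∀ p ∈ h, p.2 = outcome f u p.1 θ := by
  induction t generalizing h with
  | zero =>
    simp only [hists, Finset.mem_singleton, List.length_eq_zero_iff]
    constructor
    · rintro rfl; simp
    · exact fun h => h.1
  | succ t ih =>
    simp only [hists, Finset.mem_image, Finset.mem_product, Finset.mem_univ, true_and, ih,
      Prod.exists]
    constructor
    · rintro ⟨a, h, ⟨rfl, hc⟩, rfl⟩
      simpa using hc
    · rintro ⟨hl, hc⟩
      match h, hl with
      | ⟨a, v⟩ :: h, hl =>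
        simp only [List.mem_cons, forall_eq_or_imp] at hc
        refine ⟨a, h, ⟨by simpa using hl, hc.2⟩, ?_⟩
        rw [← hc.1]

theorem histProb_eq_zero_of_notMem {h : Hist A} (hl : h.length = t) (hh : h ∉ hists f u θ t) :
    histProb P (detD f u) θ h = 0 := by
  rw [mem_hists] at hh
  push Not at hh
  obtain ⟨p, hp, hne⟩ := hh hl
  exact histProb_eq_zero hp hne

theorem histProb_nonneg (hP : IsPolicy P) (h : Hist A) : 0 ≤ histProb P (detD f u) θ h := by
  induction h with
  | nil => simp [histProb]
  | cons p h ih =>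
    refine mul_nonneg (mul_nonneg ih ((hP _ _).1 _)) ?_
    unfold detD
    split_ifs <;> norm_num

/-- The expectation of `G`, conditional on the state `θ`, over the history of the first `t` rounds
of the policy `P`. -/
def histExp (f : JA A → Θ → ℝ) (u : (i : Fin n) → JA A → Θ → ℝ) (P : ℕ → Hist A → JA A → ℝ)
    (θ : Θ) (t : ℕ) (G : Hist A → ℝ) : ℝ :=
  ∑ h ∈ hists f u θ t, histProb P (detD f u) θ h * G h

theorem tsum_histProb (G : Hist A → ℝ) :
    (∑' h : Hist A, if h.length = t then histProb P (detD f u) θ h * G h else 0)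
      = histExp f u P θ t G := by
  rw [tsum_eq_sum (s := hists f u θ t)]
  · exact Finset.sum_congr rfl fun h hh => if_pos (mem_hists.1 hh).1
  · intro h hh
    split_ifs with hl
    · rw [histProb_eq_zero_of_notMem hl hh, zero_mul]
    · rfl

theorem roundCond_eq_histExp (g : JA A → Θ → ℝ) :
    roundCond P (detD f u) θ t g = histExp f u P θ t fun h => ∑ a : JA A, P t h a * g a θ :=
  tsum_histProb _

theorem probAt_eq_histExp (a : JA A) :
    probAt P (detD f u) θ t a = histExp f u P θ t fun h => P t h a :=
  tsum_histProb _

@[simp]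
theorem histExp_zero (G : Hist A → ℝ) : histExp f u P θ 0 G = G [] := by
  simp [histExp, hists, histProb]

theorem histExp_succ (G : Hist A → ℝ) :
    histExp f u P θ (t + 1) G =
      histExp f u P θ t fun h => ∑ a : JA A, P t h a * G ((a, outcome f u a θ) :: h) := by
  unfold histExp
  rw [hists, Finset.sum_image, Finset.sum_product_right]
  · refine Finset.sum_congr rfl fun h hh => ?_
    rw [Finset.mul_sum]
    refine Finset.sum_congr rfl fun a _ => ?_
    have : detD f u a θ (outcome f u a θ) = 1 := if_pos rfl
    simp only [histProb, (mem_hists.1 hh).1, this]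
    ring
  · rintro ⟨a, h⟩ - ⟨b, k⟩ - hab
    simp only [List.cons.injEq, Prod.mk.injEq] at hab
    rw [hab.1.1, hab.2]

theorem histExp_congr {G G' : Hist A → ℝ}
    (hG : ∀ h : Hist A, h.length = t → G h = G' h) :
    histExp f u P θ t G = histExp f u P θ t G' :=
  Finset.sum_congr rfl fun h hh => by rw [hG h (mem_hists.1 hh).1]

theorem histExp_congr_policy {Q : ℕ → Hist A → JA A → ℝ} (hPQ : ∀ s < t, P s = Q s)
    (G : Hist A → ℝ) : histExp f u P θ t G = histExp f u Q θ t G := by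
  induction t generalizing G with
  | zero => simp
  | succ t ih =>
    rw [histExp_succ, histExp_succ, ih fun s hs => hPQ s (by omega), hPQ t (by omega)]

theorem histExp_mono (hP : IsPolicy P) {G G' : Hist A → ℝ}
    (hG : ∀ h : Hist A, (∀ p ∈ h, p.2 = outcome f u p.1 θ) → G h ≤ G' h) :
    histExp f u P θ t G ≤ histExp f u P θ t G' :=
  Finset.sum_le_sum fun h hh =>
    mul_le_mul_of_nonneg_left (hG h (mem_hists.1 hh).2) (histProb_nonneg hP h)

theorem histExp_const (hP : IsPolicy P) (c : ℝ) : histExp f u P θ t (fun _ => c) = c := by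
  induction t with
  | zero => simp
  | succ t ih =>
    simp only [histExp_succ, ← Finset.sum_mul, (hP _ _).2, one_mul, ih]

theorem histExp_sub (G G' : Hist A → ℝ) :
    histExp f u P θ t (fun h => G h - G' h) = histExp f u P θ t G - histExp f u P θ t G' := by
  simp [histExp, mul_sub]

theorem histExp_sum {ι : Type*} (s : Finset ι) (G : ι → Hist A → ℝ) :
    histExp f u P θ t (fun h => ∑ i ∈ s, G i h) = ∑ i ∈ s, histExp f u P θ t (G i) := by
  simp only [histExp, Finset.mul_sum]
  exact Finset.sum_comm

theorem histExp_mul_const (G : Hist A → ℝ) (c : ℝ) :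
    histExp f u P θ t (fun h => G h * c) = histExp f u P θ t G * c := by
  simp [histExp, Finset.sum_mul, mul_assoc]

/-- An average over states and histories is nonnegative if its contribution from every single
history is. -/
theorem sum_histExp_nonneg [Fintype Θ] {ψ : Θ → ℝ} {F : Θ → Hist A → ℝ}
    (hF : ∀ h, 0 ≤ ∑ θ, ψ θ * histProb P (detD f u) θ h * F θ h) :
    0 ≤ ∑ θ, ψ θ * histExp f u P θ t (F θ) := by
  have key : ∀ θ, ψ θ * histExp f u P θ t (F θ) =
      ∑ h ∈ Finset.univ.biUnion (fun θ => hists f u θ t),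
        ψ θ * histProb P (detD f u) θ h * F θ h := by
    intro θ
    unfold histExp
    rw [Finset.sum_subset (Finset.subset_biUnion_of_mem (fun θ => hists f u θ t)
      (Finset.mem_univ θ)), Finset.mul_sum]
    · simp only [mul_assoc]
    · intro h hh hn
      obtain ⟨θ', -, hθ'⟩ := Finset.mem_biUnion.1 hh
      rw [histProb_eq_zero_of_notMem (mem_hists.1 hθ').1 hn, zero_mul]
  simp only [key]
  rw [Finset.sum_comm]
  exact Finset.sum_nonneg fun h _ => hF h

/-! ### Concatenation of policies -/

theorem isPolicy_concat (hP : IsPolicy P) (hR : ∀ h, IsPolicy (R h)) :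
    IsPolicy (concat P T R) := by
  intro t h
  by_cases ht : t < T
  · rw [concat_of_lt ht]
    exact hP t h
  · simpa [concat, ht] using hR _ _ _

theorem histExp_concat (G : Hist A → ℝ) :
    histExp f u (concat P T R) θ (T + t) G =
      histExp f u P θ T fun h => histExp f u (R h) θ t fun h' => G (h' ++ h) := by
  induction t generalizing G with
  | zero => simpa using histExp_congr_policy (fun s hs => concat_of_lt hs) G
  | succ t ih =>
    rw [← add_assoc, histExp_succ, ih]
    congr 1
    funext h
    rw [histExp_succ]
    refine histExp_congr fun h' hl => ?_
    simp only [concat_append hl, List.cons_append]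

theorem roundCond_concat_of_lt (h : t < T) (g : JA A → Θ → ℝ) :
    roundCond (concat P T R) (detD f u) θ t g = roundCond P (detD f u) θ t g := by
  rw [roundCond_eq_histExp, roundCond_eq_histExp,
    histExp_congr_policy (Q := P) fun s hs => concat_of_lt (hs.trans h), concat_of_lt h]

theorem roundCond_concat (g : JA A → Θ → ℝ) :
    roundCond (concat P T R) (detD f u) θ (T + t) g =
      histExp f u P θ T fun h => roundCond (R h) (detD f u) θ t g := by
  rw [roundCond_eq_histExp, histExp_concat]
  congr 1
  funext h
  rw [roundCond_eq_histExp]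
  exact histExp_congr fun h' hl => by rw [concat_append hl]

theorem isBIC_concat [Fintype Θ] {ψ : Θ → ℝ} {δ : ℝ} (hP : IsBIC ψ P (detD f u) u δ)
    (hR : ∀ h, IsPolicy (R h))
    (hBIC : ∀ t, BICAt ψ (concat P T R) (detD f u) u δ (T + t)) :
    IsBIC ψ (concat P T R) (detD f u) u δ := by
  refine ⟨isPolicy_concat hP.1 hR, fun t => ?_⟩
  rcases lt_or_ge t T with ht | ht
  · simpa only [BICAt, roundExp, roundCond_concat_of_lt ht] using hP.2 t
  · obtain ⟨k, rfl⟩ := Nat.exists_eq_add_of_le ht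
    exact hBIC k

theorem isBIC_concat_const [Fintype Θ] {ψ : Θ → ℝ} {Q : ℕ → Hist A → JA A → ℝ} {δ : ℝ}
    (hP : IsBIC ψ P (detD f u) u δ) (hQ : IsBIC ψ Q (detD f u) u δ) :
    IsBIC ψ (concat P T fun _ => Q) (detD f u) u δ := by
  refine isBIC_concat hP (fun _ => hQ.1) fun t => ?_
  simpa only [BICAt, roundExp, roundCond_concat, histExp_const hP.1] using hQ.2 t

/-! ### Exploration -/

/-- The probability, given the state, that the joint action is not played during the first `T`
rounds of the policy `P`. -/
def missProb (f : JA A → Θ → ℝ) (u : (i : Fin n) → JA A → Θ → ℝ) (P : ℕ → Hist A → JA A → ℝ)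
    (T : ℕ) : Θ × JA A → ℝ :=
  fun x => histExp f u P x.1 T (unseen x.2)

theorem missProb_nonneg (hP : IsPolicy P) (x : Θ × JA A) : 0 ≤ missProb f u P T x :=
  Finset.sum_nonneg fun h _ => mul_nonneg (histProb_nonneg hP h) (unseen_nonneg _ h)

theorem missProb_le_one (hP : IsPolicy P) (x : Θ × JA A) : missProb f u P T x ≤ 1 :=
  (histExp_mono hP fun h _ => unseen_le_one _ h).trans (histExp_const hP 1).le

theorem missProb_concat {Q : ℕ → Hist A → JA A → ℝ} {S : ℕ} :
    missProb f u (concat P T fun _ => Q) (T + S) = missProb f u P T * missProb f u Q S := by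
  funext x
  simp only [missProb, Pi.mul_apply, histExp_concat, unseen_append]
  rw [← histExp_mul_const]
  congr 1
  funext h
  simp only [mul_comm (unseen x.2 h), histExp_mul_const]

theorem missProb_succ_lt_one (hP : IsPolicy P) {a : JA A}
    (ha : 0 < probAt P (detD f u) θ t a) : missProb f u P (t + 1) (θ, a) < 1 := by
  have hle : missProb f u P (t + 1) (θ, a) ≤ histExp f u P θ t fun h => 1 - P t h a := by
    rw [missProb, histExp_succ]
    refine histExp_mono hP fun h _ => ?_
    have : 1 - P t h a = ∑ b : JA A, P t h b * (1 - if b = a then 1 else 0) := by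
      simp [mul_sub, (hP t h).2]
    rw [this]
    refine Finset.sum_le_sum fun b _ => mul_le_mul_of_nonneg_left ?_ ((hP t h).1 b)
    by_cases hb : b = a
    · simp [unseen, hb]
    · simpa [hb] using unseen_le_one _ _
  rw [histExp_sub, histExp_const hP, ← probAt_eq_histExp] at hle
  linarith

/-- If every joint action is eventually explorable, then BIC policies explore all of them
simultaneously with probability arbitrarily close to one. -/
theorem exists_tendsto_missProb [Fintype Θ] [∀ i, Nonempty (A i)] {ψ : Θ → ℝ} {δ : ℝ}
    (hψ : IsPrior ψ)
    (hall : ∀ θ, 0 < ψ θ → explSet ψ (detD f u) u δ θ = (Finset.univ : Finset (JA A))) :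
    ∃ (P : ℕ → ℕ → Hist A → JA A → ℝ) (T : ℕ → ℕ), (∀ k, IsBIC ψ (P k) (detD f u) u δ) ∧
      ∀ θ a, 0 < ψ θ → Filter.Tendsto (fun k => missProb f u (P k) (T k) (θ, a)) Filter.atTop
        (nhds 0) := by
  have hex : ∀ θ a, 0 < ψ θ → ∃ P, IsBIC ψ P (detD f u) u δ ∧
      ∃ T, missProb f u P T (θ, a) < 1 := by
    intro θ a hθ
    have ha : a ∈ explSet ψ (detD f u) u δ θ := by simp [hall θ hθ]
    simp only [explSet, Set.Finite.mem_toFinset, Set.mem_ofPred_eq] at ha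
    obtain ⟨P, hP, t, ht⟩ := ha
    exact ⟨P, hP, t + 1, missProb_succ_lt_one hP.1 ht⟩
  obtain ⟨P₀, hP₀⟩ : ∃ P, IsBIC ψ P (detD f u) u δ := by
    obtain ⟨θ, -, hθ⟩ := Finset.exists_lt_of_sum_lt
      (show ∑ _θ : Θ, (0 : ℝ) < ∑ θ, ψ θ by simp [hψ.2])
    obtain ⟨P, hP, -⟩ := hex θ (Classical.arbitrary _) hθ
    exact ⟨P, hP⟩
  let M : Submonoid (Θ × JA A → ℝ) :=
    { carrier := {m | ∃ P T, IsBIC ψ P (detD f u) u δ ∧ missProb f u P T = m}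
      one_mem' := ⟨P₀, 0, hP₀, by funext x; simp [missProb, unseen]⟩
      mul_mem' := by
        rintro _ _ ⟨P, T, hP, rfl⟩ ⟨Q, S, hQ, rfl⟩
        exact ⟨_, _, isBIC_concat_const hP hQ, missProb_concat⟩ }
  have h01 : ∀ m ∈ M, ∀ x, 0 ≤ m x ∧ m x ≤ 1 := by
    rintro _ ⟨P, T, hP, rfl⟩ x
    exact ⟨missProb_nonneg hP.1 x, missProb_le_one hP.1 x⟩
  have hM : ∀ x : Θ × JA A, ∃ m ∈ M, 0 < ψ x.1 → m x < 1 := by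
    rintro ⟨θ, a⟩
    by_cases hθ : 0 < ψ θ
    · obtain ⟨P, hP, T, hT⟩ := hex θ a hθ
      exact ⟨_, ⟨P, T, hP, rfl⟩, fun _ => hT⟩
    · exact ⟨1, M.one_mem, fun h => absurd h hθ⟩
  choose m hmM hm using hM
  have hprod : ∏ x, m x ∈ M := M.prod_mem fun x _ => hmM x
  choose P T hP hPT using fun k : ℕ => M.pow_mem hprod k
  refine ⟨P, T, hP, fun θ a hθ => ?_⟩
  simp only [hPT, Pi.pow_apply]
  refine tendsto_pow_atTop_nhds_zero_of_lt_one (h01 _ hprod _).1 ?_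
  rw [Finset.prod_apply, ← Finset.mul_prod_erase _ _ (Finset.mem_univ (θ, a))]
  exact (mul_le_of_le_one_right (h01 _ (hmM _) _).1 (Finset.prod_le_one
    (fun y _ => (h01 _ (hmM y) _).1) fun y _ => (h01 _ (hmM y) _).2)).trans_lt (hm _ hθ)

/-! ### The reward of a policy -/

theorem roundExp_le_sum_iSup [Fintype Θ] {ψ : Θ → ℝ} (hψ : IsPrior ψ) (hP : IsPolicy P)
    (g : JA A → Θ → ℝ) :
    roundExp ψ P (detD f u) t g ≤ ∑ θ, ψ θ * ⨆ a : JA A, g a θ := by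
  refine Finset.sum_le_sum fun θ _ => mul_le_mul_of_nonneg_left ?_ (hψ.1 θ)
  rw [roundCond_eq_histExp, ← histExp_const (f := f) (u := u) (θ := θ) (t := t) hP
    (⨆ a : JA A, g a θ)]
  refine histExp_mono hP fun h _ => ?_
  calc ∑ a : JA A, P t h a * g a θ ≤ ∑ a : JA A, P t h a * ⨆ a : JA A, g a θ :=
        Finset.sum_le_sum fun a _ => mul_le_mul_of_nonneg_left
          (le_ciSup (f := fun a => g a θ) (Set.finite_range _).bddAbove a) ((hP t h).1 a)
    _ = ⨆ a : JA A, g a θ := by rw [← Finset.sum_mul, (hP t h).2, one_mul]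

theorem isPolicy_constPolicy (a : JA A) : IsPolicy (constPolicy a) := by
  intro t h
  refine ⟨fun b => ?_, by simp [constPolicy]⟩
  unfold constPolicy
  split_ifs <;> norm_num

theorem roundCond_constPolicy (a : JA A) (g : JA A → Θ → ℝ) :
    roundCond (constPolicy a) (detD f u) θ t g = g a θ := by
  simp [roundCond_eq_histExp, constPolicy, histExp_const (isPolicy_constPolicy a)]

/-- There is a rule that, from the history alone, plays a best joint action whenever all joint
actions have been observed. -/
theorem exists_bestObserved [∀ i, Nonempty (A i)] (hu : IsUtil f u) :
    ∃ B : Hist A → JA A, ∀ (h : Hist A) (θ : Θ), (∀ p ∈ h, p.2 = outcome f u p.1 θ) →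
      (⨆ a : JA A, f a θ) - ∑ a : JA A, unseen a h ≤ f (B h) θ := by
  have hB : ∀ h : Hist A, ∃ b : JA A,
      (∃ b v, (b, v) ∈ h ∧ ∀ p ∈ h, p.2.1 ≤ v.1) → ∃ v, (b, v) ∈ h ∧ ∀ p ∈ h, p.2.1 ≤ v.1 := by
    intro h
    by_cases hb : ∃ (b : JA A) (v : UVec n), (b, v) ∈ h ∧ ∀ p ∈ h, p.2.1 ≤ v.1
    · exact ⟨hb.choose, fun _ => hb.choose_spec⟩
    · exact ⟨Classical.arbitrary _, fun hb' => absurd hb' hb⟩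
  choose B hB using hB
  refine ⟨B, fun h θ hc => ?_⟩
  obtain ⟨a₀, ha₀⟩ := exists_eq_ciSup_of_finite (f := fun a : JA A => f a θ)
  have hmax : ∀ a, f a θ ≤ f a₀ θ := fun a =>
    (le_ciSup (f := fun a => f a θ) (Set.finite_range _).bddAbove a).trans ha₀.ge
  rw [← ha₀]
  by_cases hseen : ∃ p ∈ h, p.1 = a₀
  · obtain ⟨⟨_, v⟩, hp, rfl⟩ := hseen
    obtain ⟨w, hw, hwmax⟩ := hB h ⟨_, v, hp, fun q hq => by
      rw [hc q hq, show v = outcome f u _ θ from hc _ hp]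
      exact hmax _⟩
    have hle := hwmax _ hp
    rw [show v = outcome f u _ θ from hc _ hp, show w = outcome f u (B h) θ from hc _ hw] at hle
    exact (sub_le_self _ (Finset.sum_nonneg fun a _ => unseen_nonneg a h)).trans hle
  · have h1 : unseen a₀ h = 1 := if_neg hseen
    have h2 := Finset.single_le_sum (f := fun a => unseen a h) (fun a _ => unseen_nonneg a h)
      (Finset.mem_univ a₀)
    have h3 := (hu.1 a₀ θ).2
    have h4 := (hu.1 (B h) θ).1
    simp only [h1] at h2
    linarith

end Histories

/-- With a single agent whose utility is the reward, any BIC policy can be followed from round `T`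
on by the Bayes-optimal action given the first `T` rounds, which loses at most the probability that
some action has not been explored by then. -/
theorem exists_isBIC_ge {A : Fin 1 → Type} [Fintype Θ] [∀ i, Fintype (A i)] [∀ i, Nonempty (A i)]
    {ψ : Θ → ℝ} {f : JA A → Θ → ℝ} {u : (i : Fin 1) → JA A → Θ → ℝ} (hψ : IsPrior ψ)
    (hu : IsUtil f u) (hfu : ∀ (a : JA A) (θ : Θ), f a θ = u 0 a θ)
    {P : ℕ → Hist A → JA A → ℝ} (hP : IsBIC ψ P (detD f u) u 0) (T : ℕ) :
    ∃ Q, IsBIC ψ Q (detD f u) u 0 ∧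
      ∑ θ, ψ θ * ((⨆ a : JA A, f a θ) - ∑ a : JA A, missProb f u P T (θ, a)) ≤
        roundExp ψ Q (detD f u) T f := by
  have hG : ∀ h : Hist A, ∃ a : JA A, ∀ b : JA A,
      ∑ θ, ψ θ * histProb P (detD f u) θ h * f b θ ≤
        ∑ θ, ψ θ * histProb P (detD f u) θ h * f a θ :=
    fun h => Finite.exists_max fun b : JA A => ∑ θ, ψ θ * histProb P (detD f u) θ h * f b θ
  choose G hG using hG
  have hround : ∀ t g, roundExp ψ (concat P T fun h => constPolicy (G h)) (detD f u) (T + t) g =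
      ∑ θ, ψ θ * histExp f u P θ T fun h => g (G h) θ := fun t g => by
    simp only [roundExp, roundCond_concat, roundCond_constPolicy]
  refine ⟨concat P T fun h => constPolicy (G h),
    isBIC_concat hP (fun h => isPolicy_constPolicy _) fun t i ai ai' => ?_, ?_⟩
  · rw [zero_mul, hround]
    refine sum_histExp_nonneg fun h => ?_
    obtain rfl := Subsingleton.elim i 0
    by_cases hi : G h 0 = ai
    · simp only [hi, if_true, ← hfu, mul_sub, Finset.sum_sub_distrib, sub_nonneg]
      exact hG h _
    · simp [hi]
  · obtain ⟨B, hB⟩ := exists_bestObserved hu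
    have hGB := sum_histExp_nonneg (f := f) (u := u) (P := P) (ψ := ψ) (t := T)
      (F := fun θ h => f (G h) θ - f (B h) θ) fun h => by
        simp only [mul_sub, Finset.sum_sub_distrib, sub_nonneg]
        exact hG h _
    simp only [histExp_sub, mul_sub, Finset.sum_sub_distrib, sub_nonneg] at hGB
    have hround0 := hround 0 f
    rw [add_zero] at hround0
    rw [hround0]
    refine le_trans (Finset.sum_le_sum fun θ _ => mul_le_mul_of_nonneg_left ?_ (hψ.1 θ)) hGB
    simp only [missProb]
    rw [← histExp_sum, ← histExp_const (f := f) (u := u) (θ := θ) (t := T) hP.1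
      (⨆ a : JA A, f a θ), ← histExp_sub]
    exact histExp_mono hP.1 fun h hc => by simpa only [histExp_const hP.1] using hB h θ hc

/-- (deterministic utilities, single agent per round, principal's
reward equal to the agent's utility, and every action eventually-explorable in every
state in the support of the prior) the benchmark `OPT(Π_BIC)` equals the expected
reward of the best fixed action. -/
theorem single_agent_all_explorable_benchmark
    {Θ : Type} {A : Fin 1 → Type} [Fintype Θ] [∀ i, Fintype (A i)]
    [∀ i, Nonempty (A i)]
    (ψ : Θ → ℝ) (f : JA A → Θ → ℝ) (u : (i : Fin 1) → JA A → Θ → ℝ)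
    (hψ : IsPrior ψ) (hu : IsUtil f u)
    (hfu : ∀ (a : JA A) (θ : Θ), f a θ = u 0 a θ)
    (hall : ∀ θ : Θ, 0 < ψ θ → explSet ψ (detD f u) u 0 θ = (Finset.univ : Finset (JA A))) :
    OPT ψ (detD f u) f (fun P => IsBIC ψ P (detD f u) u 0)
      = ∑ θ, ψ θ * (⨆ a : JA A, f a θ) := by
  refine le_antisymm ?_ ?_
  · refine Real.sSup_le ?_ (Finset.sum_nonneg fun θ _ =>
      mul_nonneg (hψ.1 θ) (Real.iSup_nonneg fun a => (hu.1 a θ).1))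
    rintro _ ⟨P, hP, t, rfl⟩
    exact roundExp_le_sum_iSup hψ hP.1 f
  · obtain ⟨P, T, hP, hlim⟩ := exists_tendsto_missProb hψ hall
    have hbound : ∀ k, ∑ θ, ψ θ * ((⨆ a : JA A, f a θ) -
        ∑ a : JA A, missProb f u (P k) (T k) (θ, a)) ≤
          OPT ψ (detD f u) f (fun P => IsBIC ψ P (detD f u) u 0) := by
      intro k
      obtain ⟨Q, hQ, hle⟩ := exists_isBIC_ge hψ hu hfu (hP k) (T k)
      refine hle.trans (le_csSup ⟨∑ θ, ψ θ * ⨆ a : JA A, f a θ, ?_⟩ ⟨Q, hQ, T k, rfl⟩)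
      rintro _ ⟨P, hP, t, rfl⟩
      exact roundExp_le_sum_iSup hψ hP.1 f
    refine le_of_tendsto' (x := Filter.atTop) (tendsto_finsetSum _ fun θ _ => ?_) hbound
    rcases (hψ.1 θ).eq_or_lt with hθ | hθ
    · simp [← hθ]
    · have := tendsto_finsetSum Finset.univ fun a (_ : a ∈ Finset.univ) => hlim θ a hθ
      simpa using (this.const_sub (⨆ a : JA A, f a θ)).const_mul (ψ θ)

end BE

end
end

section
/- Induced policy equivalence: consider a recommendation game with coupled signals S (support X) and S' (support X'), where S is at least as informative as S'. Let π' be any recommendation policy for S', and let π be the induced policy for S, defined by Pr[π(s)=a] = Pr[π'(S')=a | S=s] for all a ∈ A, s ∈ X. Then for every function h : A × Θ → ℝ, E[h(π(S), θ*)] = E[h(π'(S'), θ*)], where the expectations are over (S, S', θ*) and the policies' independent internal randomization. In particular, REW(π) = REW(π'), and if π' is BIC for S' then the induced policy π is BIC for S. -/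
open scoped BigOperators

attribute [local instance] Classical.propDecidable

noncomputable section

namespace BE

variable {n : ℕ} {Θ : Type} {A : Fin n → Type} {X : Type} {X' : Type}

/-- Marginal kernel of the first signal `S` in a coupling `j` of two signals. -/
def margS {Θ : Type} {X : Type} {X' : Type} (j : Θ → X → X' → ℝ) : Θ → X → ℝ :=
  fun θ s => ∑' s' : X', j θ s s'

/-- Marginal kernel of the second signal `S'` in a coupling `j` of two signals. -/
def margS' {Θ : Type} {X : Type} {X' : Type} (j : Θ → X → X' → ℝ) : Θ → X' → ℝ :=
  fun θ s' => ∑' s : X, j θ s s'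

/-- A coupling of two signals: given the state, a joint distribution over `X × X'`. -/
def IsJointKernel {Θ : Type} {X : Type} {X' : Type} (j : Θ → X → X' → ℝ) : Prop :=
  ∀ θ, (∀ s s', 0 ≤ j θ s s') ∧ HasSum (fun p : X × X' => j θ p.1 p.2) 1

/-- `S` is at least as informative as `S'`:
`Pr[θ* = θ | S = s, S' = s'] = Pr[θ* = θ | S = s]` whenever `Pr[S = s, S' = s'] > 0`
(stated in cross-multiplied form). -/
def MoreInformative {Θ : Type} {X : Type} {X' : Type} [Fintype Θ]
    (ψ : Θ → ℝ) (j : Θ → X → X' → ℝ) : Prop :=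
  ∀ (θ : Θ) (s : X) (s' : X'), 0 < ∑ τ, ψ τ * j τ s s' →
    (ψ θ * j θ s s') * (∑ τ, ψ τ * margS j τ s)
      = (ψ θ * margS j θ s) * (∑ τ, ψ τ * j τ s s')

lemma IsRecPolicy.le_one [∀ i, Fintype (A i)] {x : JA A → X → ℝ} (hx : IsRecPolicy x)
    (a : JA A) (s : X) : x a s ≤ 1 :=
  hx.2 s ▸ Finset.single_le_sum (f := fun b => x b s) (fun b _ => hx.1 b s) (Finset.mem_univ a)

lemma IsRecPolicy.summable_mul [∀ i, Fintype (A i)] {x : JA A → X → ℝ} (hx : IsRecPolicy x)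
    {q : X → ℝ} (hq : ∀ s, 0 ≤ q s) (hs : Summable q) (a : JA A) :
    Summable fun s => q s * x a s :=
  Summable.of_nonneg_of_le (fun s => mul_nonneg (hq s) (hx.1 a s))
    (fun s => mul_le_of_le_one_right (hq s) (hx.le_one a s)) hs

namespace IsJointKernel

variable {j : Θ → X → X' → ℝ}

lemma summable_right (hj : IsJointKernel j) (θ : Θ) (s : X) : Summable fun s' => j θ s s' :=
  (hj θ).2.summable.prod_factor s

lemma margS_nonneg (hj : IsJointKernel j) (θ : Θ) (s : X) : 0 ≤ margS j θ s :=
  tsum_nonneg fun s' => (hj θ).1 s s'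

lemma margS'_nonneg (hj : IsJointKernel j) (θ : Θ) (s' : X') : 0 ≤ margS' j θ s' :=
  tsum_nonneg fun s => (hj θ).1 s s'

lemma summable_margS (hj : IsJointKernel j) (θ : Θ) : Summable (margS j θ) :=
  (hj θ).2.summable.prod

lemma summable_margS' (hj : IsJointKernel j) (θ : Θ) : Summable (margS' j θ) :=
  (hj θ).2.summable.prod_symm.prod

lemma tsum_margS'_mul [∀ i, Fintype (A i)] (hj : IsJointKernel j) {x' : JA A → X' → ℝ}
    (hx' : IsRecPolicy x') (θ : Θ) (a : JA A) :
    ∑' s', margS' j θ s' * x' a s' = ∑' s, ∑' s', j θ s s' * x' a s' := by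
  have hsum : Summable (Function.uncurry fun s s' => j θ s s' * x' a s') :=
    Summable.of_nonneg_of_le (fun p => mul_nonneg ((hj θ).1 p.1 p.2) (hx'.1 a p.2))
      (fun p => mul_le_of_le_one_right ((hj θ).1 p.1 p.2) (hx'.le_one a p.2)) (hj θ).2.summable
  rw [← hsum.tsum_comm]
  exact tsum_congr fun s' => tsum_mul_right.symm

end IsJointKernel

/-- Given the state and the informative signal, the induced policy plays each joint action
with the same weight as the original one. -/
lemma induced_weight_eq [Fintype Θ] [∀ i, Fintype (A i)] {ψ : Θ → ℝ} {j : Θ → X → X' → ℝ}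
    (hψ : ∀ θ, 0 ≤ ψ θ) (hj : IsJointKernel j) (hMI : MoreInformative ψ j)
    {x' : JA A → X' → ℝ} (hx' : IsRecPolicy x') {x : JA A → X → ℝ}
    (hind : ∀ (a : JA A) (s : X),
      x a s * (∑ θ, ψ θ * margS j θ s) = ∑ θ, ψ θ * ∑' s' : X', j θ s s' * x' a s')
    (θ : Θ) (a : JA A) (s : X) :
    ψ θ * (margS j θ s * x a s) = ψ θ * ∑' s', j θ s s' * x' a s' := by
  have hsum (τ : Θ) : Summable fun s' => j τ s s' * x' a s' :=
    hx'.summable_mul ((hj τ).1 s) (hj.summable_right τ s) a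
  have hterm (τ : Θ) : 0 ≤ ψ τ * margS j τ s := mul_nonneg (hψ τ) (hj.margS_nonneg τ s)
  by_cases hW : ∑ τ, ψ τ * margS j τ s = 0
  · have h0 : ψ θ * margS j θ s = 0 :=
      (Finset.sum_eq_zero_iff_of_nonneg fun τ _ => hterm τ).1 hW θ (Finset.mem_univ θ)
    have hle : ∑' s', j θ s s' * x' a s' ≤ margS j θ s :=
      (hsum θ).tsum_le_tsum
        (fun s' => mul_le_of_le_one_right ((hj θ).1 s s') (hx'.le_one a s'))
        (hj.summable_right θ s)
    have hge : 0 ≤ ∑' s', j θ s s' * x' a s' :=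
      tsum_nonneg fun s' => mul_nonneg ((hj θ).1 s s') (hx'.1 a s')
    rw [← mul_assoc, h0, zero_mul]
    exact le_antisymm (mul_nonneg (hψ θ) hge)
      ((mul_le_mul_of_nonneg_left hle (hψ θ)).trans_eq h0)
  · have hcross (s' : X') : (ψ θ * j θ s s') * (∑ τ, ψ τ * margS j τ s)
        = (ψ θ * margS j θ s) * (∑ τ, ψ τ * j τ s s') := by
      have hpos (τ : Θ) : 0 ≤ ψ τ * j τ s s' := mul_nonneg (hψ τ) ((hj τ).1 s s')
      rcases (Finset.sum_nonneg fun τ _ => hpos τ).lt_or_eq with h | h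
      · exact hMI θ s s' h
      · rw [(Finset.sum_eq_zero_iff_of_nonneg fun τ _ => hpos τ).1 h.symm θ (Finset.mem_univ θ),
          ← h, zero_mul, mul_zero]
    apply mul_right_cancel₀ hW
    calc ψ θ * (margS j θ s * x a s) * (∑ τ, ψ τ * margS j τ s)
        = (ψ θ * margS j θ s) * ∑ τ, ψ τ * ∑' s', j τ s s' * x' a s' := by
          rw [← hind a s]; ring
      _ = (ψ θ * margS j θ s) * ∑' s', ∑ τ, ψ τ * (j τ s s' * x' a s') := by
          rw [Summable.tsum_finsetSum fun τ _ => (hsum τ).mul_left (ψ τ)]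
          simp only [tsum_mul_left]
      _ = ∑' s', (∑ τ, ψ τ * margS j τ s) * (ψ θ * (j θ s s' * x' a s')) := by
          rw [← tsum_mul_left]
          refine tsum_congr fun s' => ?_
          simp only [← mul_assoc (ψ _) (j _ s s'), ← Finset.sum_mul]
          linear_combination -(x' a s') * hcross s'
      _ = ψ θ * (∑' s', j θ s s' * x' a s') * (∑ τ, ψ τ * margS j τ s) := by
          rw [tsum_mul_left, tsum_mul_left]; ring

lemma recREW_eq_sum [Fintype Θ] [∀ i, Fintype (A i)] (ψ : Θ → ℝ) {q : Θ → X → ℝ}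
    (hq : ∀ θ s, 0 ≤ q θ s) (hs : ∀ θ, Summable (q θ)) {x : JA A → X → ℝ}
    (hx : IsRecPolicy x) (h : JA A → Θ → ℝ) :
    recREW ψ q h x = ∑ θ, ∑ a, (ψ θ * ∑' s, q θ s * x a s) * h a θ := by
  refine Finset.sum_congr rfl fun θ _ => ?_
  simp only [Finset.mul_sum, ← mul_assoc]
  rw [Summable.tsum_finsetSum fun a _ => (hx.summable_mul (hq θ) (hs θ) a).mul_right (h a θ),
    Finset.mul_sum]
  exact Finset.sum_congr rfl fun a _ => by rw [tsum_mul_right, mul_assoc]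

lemma inBIC_zero_iff [Fintype Θ] [∀ i, Fintype (A i)] {ψ : Θ → ℝ} {q : Θ → X → ℝ}
    {u : (i : Fin n) → JA A → Θ → ℝ} {x : JA A → X → ℝ} :
    InBIC ψ q u 0 x ↔ IsRecPolicy x ∧ ∀ (i : Fin n) (ai ai' : A i),
      0 ≤ recREW ψ q
        (fun a θ => if a i = ai then u i a θ - u i (Function.update a i ai') θ else 0) x := by
  simp only [InBIC, recREW, zero_mul, mul_comm (x _ _), ite_mul]

/-- induced-policy equivalence. Let `j` couple signals `S` (support
`X`) and `S'` (support `X'`), with `S` at least as informative as `S'`. Let `x'` be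
any recommendation policy for `S'`, and let `x` be the induced policy for `S`,
defined by `Pr[π(s) = a] · Pr[S = s] = Pr[π'(S') = a ∧ S = s]` (the cross-multiplied
form of `Pr[π(s) = a] = Pr[π'(S') = a | S = s]`). Then for every function
`h : A × Θ → ℝ` the expectations `E[h(π(S), θ*)]` and `E[h(π'(S'), θ*)]` coincide;
in particular `REW(π) = REW(π')`, and if `x'` is BIC for `S'` then `x` is BIC
for `S`. -/
theorem induced_policy_equivalence
    {n : ℕ} {Θ : Type} {A : Fin n → Type} {X : Type} {X' : Type}
    [Fintype Θ] [∀ i, Fintype (A i)]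
    (ψ : Θ → ℝ) (f : JA A → Θ → ℝ) (u : (i : Fin n) → JA A → Θ → ℝ)
    (j : Θ → X → X' → ℝ)
    (hψ : IsPrior ψ) (hu : IsUtil f u) (hj : IsJointKernel j)
    (hMI : MoreInformative ψ j)
    (x' : JA A → X' → ℝ) (hx' : IsRecPolicy x')
    (x : JA A → X → ℝ) (hx : IsRecPolicy x)
    (hind : ∀ (a : JA A) (s : X),
      x a s * (∑ θ, ψ θ * margS j θ s)
        = ∑ θ, ψ θ * ∑' s' : X', j θ s s' * x' a s') :
    (∀ h : JA A → Θ → ℝ, recREW ψ (margS j) h x = recREW ψ (margS' j) h x') ∧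
    recREW ψ (margS j) f x = recREW ψ (margS' j) f x' ∧
    (InBIC ψ (margS' j) u 0 x' → InBIC ψ (margS j) u 0 x) := by
  have key (h : JA A → Θ → ℝ) : recREW ψ (margS j) h x = recREW ψ (margS' j) h x' := by
    rw [recREW_eq_sum ψ hj.margS_nonneg hj.summable_margS hx,
      recREW_eq_sum ψ hj.margS'_nonneg hj.summable_margS' hx']
    refine Finset.sum_congr rfl fun θ _ => Finset.sum_congr rfl fun a _ => ?_
    rw [hj.tsum_margS'_mul hx', ← tsum_mul_left, ← tsum_mul_left,
      tsum_congr (induced_weight_eq hψ.1 hj hMI hx' hind θ a)]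
  refine ⟨key, key f, fun hBIC => inBIC_zero_iff.2 ⟨hx, fun i ai ai' => ?_⟩⟩
  rw [key]
  exact (inBIC_zero_iff.1 hBIC).2 i ai ai'

end BE

end
end
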